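/- Let f_A, f_B : Finset H → {0,1} be increasing functions with f_A(∅) = f_B(∅) = 0 and f_A(H) = f_B(H) = 1 (monotone simple games). Then the merger probability Π₃(S) = (f_A ⋆ f_B)(S) is increasing in S, and Π₃(H) = E_μ[f_A f_B] ≥ Π₃(∅) = E_μ[f_A]E_μ[f_B]. -/

import Mathlib

open Finset

noncomputable section

variable {H : Type*}

/-- P(X,Y) = ∏_{h∈X∩Y} p_h · ∏_{h∈X∖Y} (1-p_h) -/
def wtP [DecidableEq H] (p : H → ℝ) (X Y : Finset H) : ℝ :=
  (∏ h ∈ X ∩ Y, p h) * ∏ h ∈ X \ Y, (1 - p h)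

/-- Coupled coin-tossing measure μ_S on pairs of subsets of H. -/
def muPair [Fintype H] [DecidableEq H] (p : H → ℝ) (S S₁ S₂ : Finset H) : ℝ :=
  if S ∩ S₁ = S ∩ S₂ then
    wtP p S S₁ * wtP p (univ \ S) S₁ * wtP p (univ \ S) S₂
  else 0

/-- Convolution (f ⋆ g)(S) = Σ_{S₁,S₂} f(S₁) g(S₂) μ_S(S₁,S₂). -/
def starC [Fintype H] [DecidableEq H] (p : H → ℝ) (f g : Finset H → ℝ) (S : Finset H) : ℝ :=
  ∑ S₁ : Finset H, ∑ S₂ : Finset H, f S₁ * g S₂ * muPair p S S₁ S₂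

/-- Product Bernoulli measure μ(S) = ∏_{h∈S} p_h ∏_{h∉S} (1-p_h). -/
def muB [Fintype H] [DecidableEq H] (p : H → ℝ) (S : Finset H) : ℝ :=
  (∏ h ∈ S, p h) * ∏ h ∈ Sᶜ, (1 - p h)

/-- Expectation with respect to the product Bernoulli measure. -/
def expB [Fintype H] [DecidableEq H] (p : H → ℝ) (f : Finset H → ℝ) : ℝ :=
  ∑ S : Finset H, f S * muB p S

/-- Probability that a coin with bias `q` shows the outcome `a`. -/
def coinWeight (q : ℝ) (a : Prop) [Decidable a] : ℝ := if a then q else 1 - q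

lemma coinWeight_nonneg {q : ℝ} (hq : 0 ≤ q ∧ q ≤ 1) (a : Prop) [Decidable a] :
    0 ≤ coinWeight q a := by
  unfold coinWeight
  split_ifs <;> linarith [hq.1, hq.2]

/-- Joint probability of the outcomes `a` and `b` of two coins with bias `q`, which are
identical if `s` holds and independent otherwise. -/
def coupledWeight (q : ℝ) (s a b : Prop) [Decidable s] [Decidable a] [Decidable b] : ℝ :=
  if s then (if a ↔ b then coinWeight q a else 0) else coinWeight q a * coinWeight q b

lemma coupledWeight_nonneg {q : ℝ} (hq : 0 ≤ q ∧ q ≤ 1) (s a b : Prop)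
    [Decidable s] [Decidable a] [Decidable b] : 0 ≤ coupledWeight q s a b := by
  have ha := coinWeight_nonneg hq a
  have hb := coinWeight_nonneg hq b
  unfold coupledWeight
  split_ifs <;> positivity

lemma wtP_eq_prod [DecidableEq H] (p : H → ℝ) (X Y : Finset H) :
    wtP p X Y = ∏ h ∈ X, coinWeight (p h) (h ∈ Y) := by
  unfold wtP coinWeight
  rw [prod_ite, filter_mem_eq_inter, filter_notMem_eq_sdiff]

lemma muPair_eq_prod [Fintype H] [DecidableEq H] (p : H → ℝ) (S S₁ S₂ : Finset H) :
    muPair p S S₁ S₂ = ∏ h, coupledWeight (p h) (h ∈ S) (h ∈ S₁) (h ∈ S₂) := by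
  unfold muPair
  split_ifs with hS
  · rw [wtP_eq_prod, wtP_eq_prod, wtP_eq_prod, mul_assoc, ← prod_mul_distrib,
      ← prod_mul_prod_compl S, ← compl_eq_univ_sdiff]
    congr 1
    · refine prod_congr rfl fun h hh => ?_
      have := Finset.ext_iff.mp hS h
      simp only [mem_inter, hh, true_and] at this
      simp [coupledWeight, hh, this]
    · refine prod_congr rfl fun h hh => ?_
      simp [coupledWeight, mem_compl.mp hh]
  · obtain ⟨h, hh⟩ := not_forall.mp (mt Finset.ext_iff.mpr hS)
    have hs : h ∈ S := by
      by_contra hn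
      simp [hn] at hh
    simp only [mem_inter, hs, true_and] at hh
    exact (prod_eq_zero (mem_univ h) (by simp [coupledWeight, hs, hh])).symm

lemma wtP_univ [Fintype H] [DecidableEq H] (p : H → ℝ) (S : Finset H) :
    wtP p univ S = muB p S := by
  simp [wtP, muB, compl_eq_univ_sdiff]

lemma starC_univ [Fintype H] [DecidableEq H] (p : H → ℝ) (f g : Finset H → ℝ) :
    starC p f g univ = expB p (fun S => f S * g S) := by
  have hw (S : Finset H) : wtP p ∅ S = 1 := by simp [wtP]
  simp [starC, expB, muPair, hw, wtP_univ]

lemma starC_empty [Fintype H] [DecidableEq H] (p : H → ℝ) (f g : Finset H → ℝ) :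
    starC p f g ∅ = expB p f * expB p g := by
  have hw (S : Finset H) : wtP p ∅ S = 1 := by simp [wtP]
  simp only [starC, expB, muPair, hw, wtP_univ, sdiff_empty, empty_inter, if_true, one_mul,
    sum_mul_sum]
  exact sum_congr rfl fun _ _ => sum_congr rfl fun _ _ => by ring

lemma sum_finset_eq_sum_powerset_erase [Fintype H] [DecidableEq H] (a : H) (F : Finset H → ℝ) :
    ∑ S, F S = ∑ T ∈ (univ.erase a).powerset, (F T + F (insert a T)) := by
  rw [sum_add_distrib, ← sum_powerset_insert (notMem_erase a univ), insert_erase (mem_univ a),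
    powerset_univ]

lemma starC_le_starC_insert [Fintype H] [DecidableEq H] {p : H → ℝ}
    (hp : ∀ h, 0 ≤ p h ∧ p h ≤ 1) {f g : Finset H → ℝ} (hf : Monotone f) (hg : Monotone g)
    {a : H} {S : Finset H} (ha : a ∉ S) : starC p f g S ≤ starC p f g (insert a S) := by
  unfold starC
  simp only [sum_finset_eq_sum_powerset_erase a, ← sum_add_distrib]
  refine sum_le_sum fun T₁ h₁ => sum_le_sum fun T₂ h₂ => ?_
  have h₁ : a ∉ T₁ := fun h => by simpa using mem_powerset.mp h₁ h
  have h₂ : a ∉ T₂ := fun h => by simpa using mem_powerset.mp h₂ h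
  set W := ∏ h ∈ univ.erase a, coupledWeight (p h) (h ∈ S) (h ∈ T₁) (h ∈ T₂) with hW
  have hW0 : 0 ≤ W := prod_nonneg fun h _ => coupledWeight_nonneg (hp h) _ _ _
  have key (U U₁ U₂ : Finset H) (hU : ∀ h ≠ a, (h ∈ U ↔ h ∈ S))
      (hU₁ : ∀ h ≠ a, (h ∈ U₁ ↔ h ∈ T₁)) (hU₂ : ∀ h ≠ a, (h ∈ U₂ ↔ h ∈ T₂)) :
      muPair p U U₁ U₂ = coupledWeight (p a) (a ∈ U) (a ∈ U₁) (a ∈ U₂) * W := by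
    rw [muPair_eq_prod, ← mul_prod_erase univ _ (mem_univ a), hW]
    congr 1
    refine prod_congr rfl fun h hh => ?_
    have hne := ne_of_mem_erase hh
    simp only [hU h hne, hU₁ h hne, hU₂ h hne]
  have hins (T : Finset H) : ∀ h ≠ a, (h ∈ insert a T ↔ h ∈ T) := fun h hne => by
    simp [hne]
  have hid (T : Finset H) : ∀ h ≠ a, (h ∈ T ↔ h ∈ T) := fun _ _ => Iff.rfl
  rw [key S _ _ (hid _) (hid _) (hid _), key S _ _ (hid _) (hins _) (hid _),
    key S _ _ (hid _) (hid _) (hins _), key S _ _ (hid _) (hins _) (hins _),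
    key (insert a S) _ _ (hins _) (hid _) (hid _), key (insert a S) _ _ (hins _) (hins _) (hid _),
    key (insert a S) _ _ (hins _) (hid _) (hins _), key (insert a S) _ _ (hins _) (hins _) (hins _)]
  simp only [coupledWeight, coinWeight, ha, h₁, h₂, mem_insert_self, if_true, if_false,
    iff_false, false_iff, not_true_eq_false]
  have hf' : 0 ≤ f (insert a T₁) - f T₁ := sub_nonneg.mpr (hf (subset_insert a T₁))
  have hg' : 0 ≤ g (insert a T₂) - g T₂ := sub_nonneg.mpr (hg (subset_insert a T₂))
  have hpa := mul_nonneg (hp a).1 (sub_nonneg.mpr (hp a).2)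
  linarith [mul_nonneg (mul_nonneg hpa hW0) (mul_nonneg hf' hg')]

lemma monotone_starC [Fintype H] [DecidableEq H] {p : H → ℝ}
    (hp : ∀ h, 0 ≤ p h ∧ p h ≤ 1) {f g : Finset H → ℝ} (hf : Monotone f) (hg : Monotone g) :
    Monotone (starC p f g) := by
  have hunion (T U : Finset H) : starC p f g T ≤ starC p f g (U ∪ T) := by
    induction U using Finset.induction_on with
    | empty => simp
    | insert a U _ ih =>
      rw [insert_union]
      by_cases h : a ∈ U ∪ T
      · rwa [insert_eq_of_mem h]
      · exact ih.trans (starC_le_starC_insert hp hf hg h)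
  intro T S hTS
  simpa [union_eq_left.mpr hTS] using hunion T S

theorem merger_probability [Fintype H] [DecidableEq H] (p : H → ℝ)
    (hp : ∀ h, 0 ≤ p h ∧ p h ≤ 1) (fA fB : Finset H → ℝ)
    (hA01 : ∀ S, fA S = 0 ∨ fA S = 1) (hB01 : ∀ S, fB S = 0 ∨ fB S = 1)
    (hA : ∀ ⦃S T : Finset H⦄, T ⊆ S → fA T ≤ fA S)
    (hB : ∀ ⦃S T : Finset H⦄, T ⊆ S → fB T ≤ fB S)
    (hA0 : fA ∅ = 0) (hB0 : fB ∅ = 0) (hA1 : fA Finset.univ = 1)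
    (hB1 : fB Finset.univ = 1) :
    (∀ ⦃S T : Finset H⦄, T ⊆ S → starC p fA fB T ≤ starC p fA fB S) ∧
    starC p fA fB Finset.univ = expB p (fun S => fA S * fB S) ∧
    starC p fA fB ∅ = expB p fA * expB p fB ∧
    expB p fA * expB p fB ≤ expB p (fun S => fA S * fB S) := by
  have hmono : Monotone (starC p fA fB) :=
    monotone_starC hp (fun _ _ h => hA h) (fun _ _ h => hB h)
  refine ⟨fun _ _ h => hmono h, starC_univ p fA fB, starC_empty p fA fB, ?_⟩
  rw [← starC_univ, ← starC_empty]
  exact hmono (empty_subset univ)
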